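/- Let $k$ be an algebraically closed field of characteristic zero, $K$ a field extension of $k$, and let $u_1,u_2,v_1,v_2,w_1,w_2 \in K$ be algebraically independent over $k$. Define $t_{i,j,k} := (u_i+v_j)/(v_j+w_k)$. If $x \in K$ is algebraic over each of the four subfields $k(t_{1,1,1},t_{2,1,1})$, $k(t_{1,2,1},t_{2,2,1})$, $k(t_{1,1,2},t_{2,1,2})$, and $k(t_{1,2,2},t_{2,2,2})$, then $x$ is algebraic over $k$. -/

import Mathlib

open AlgebraicIndependent in
theorem mem_matroid_closure_iff {F E : Type*} [Field F] [Field E] [Algebra F E] {s : Set E}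
    {x : E} : x ∈ (matroid F E).closure s ↔ IsAlgebraic (IntermediateField.adjoin F s) x := by
  rw [matroid_closure_eq, SetLike.mem_coe, Subalgebra.mem_algebraicClosure,
    IntermediateField.isAlgebraic_adjoin_iff]

theorem Matroid.Indep.closure_inter_closure_eq_loops {α : Type*} {M : Matroid α} {S I J : Set α}
    (hS : M.Indep S) (hfin : S.Finite) (hI : I ⊆ M.E) (hJ : J ⊆ M.E)
    (hsub : S ⊆ M.closure (I ∪ J)) (hcard : I.encard + J.encard ≤ S.encard) :
    M.closure I ∩ M.closure J = M.closure ∅ := by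
  have hrk : S.encard ≤ M.eRk (I ∪ J) := by
    rw [← hS.eRk_eq_encard, ← M.eRk_closure_eq (I ∪ J)]
    exact M.eRk_mono hsub
  have hadd := Set.encard_union_add_encard_inter I J
  obtain ⟨B, hB⟩ := M.exists_isBasis (I ∪ J) (Set.union_subset hI hJ)
  have hunion_le : (I ∪ J).encard ≤ S.encard :=
    (Set.encard_union_le I J).trans hcard
  have hS_top : S.encard ≠ ⊤ := Set.encard_ne_top_iff.2 hfin
  have hunion_fin : (I ∪ J).Finite :=
    Set.encard_ne_top_iff.1 (ne_top_of_le_ne_top hS_top hunion_le)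
  have hBeq : B = I ∪ J := by
    refine (hunion_fin.subset hB.subset).eq_of_subset_of_encard_le hB.subset ?_
    rw [hB.encard_eq_eRk]
    exact hunion_le.trans hrk
  have hinter : I ∩ J = ∅ := by
    rw [← Set.encard_eq_zero]
    have hle : S.encard + (I ∩ J).encard ≤ S.encard + 0 := by
      rw [add_zero]
      calc S.encard + (I ∩ J).encard ≤ (I ∪ J).encard + (I ∩ J).encard :=
            add_le_add_left (hrk.trans (M.eRk_le_encard _)) _
        _ ≤ S.encard := hadd.trans_le hcard
    exact nonpos_iff_eq_zero.1 ((ENat.add_le_add_iff_left hS_top).1 hle)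
  rw [← (hBeq ▸ hB.indep : M.Indep (I ∪ J)).closure_inter_eq_inter_closure, hinter]

theorem AlgebraicIndependent.add_ne_zero {ι R A : Type*} [CommRing R] [Nontrivial R] [CommRing A]
    [Algebra R A] {f : ι → A} (hf : AlgebraicIndependent R f) {i j : ι} (hij : i ≠ j) :
    f i + f j ≠ 0 := by
  classical
  intro h
  have hX : (MvPolynomial.X i + MvPolynomial.X j : MvPolynomial ι R) = 0 :=
    hf.eq_zero_of_aeval_eq_zero _ (by simpa using h)
  simpa [hij.symm] using congrArg (MvPolynomial.eval (Pi.single i 1)) hX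

/-- With `u₁,u₂,v₁,v₂,w₁,w₂ ∈ K` algebraically independent over the
algebraically closed field `k` of characteristic zero and `t i j l = (uᵢ+vⱼ)/(vⱼ+wₗ)`,
any `x ∈ K` algebraic over each of the four subfields `k(t₁ⱼₗ, t₂ⱼₗ)` (the frame `𝓘₃`)
is algebraic over `k`. -/
theorem twisted_frame_three_base {k K : Type*} [Field k] [IsAlgClosed k] [CharZero k]
    [Field K] [Algebra k K] (u₁ u₂ v₁ v₂ w₁ w₂ : K)
    (hind : AlgebraicIndependent k ![u₁, u₂, v₁, v₂, w₁, w₂]) (x : K)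
    (h11 : IsAlgebraic (IntermediateField.adjoin k
      {(u₁ + v₁) / (v₁ + w₁), (u₂ + v₁) / (v₁ + w₁)} : IntermediateField k K) x)
    (h21 : IsAlgebraic (IntermediateField.adjoin k
      {(u₁ + v₂) / (v₂ + w₁), (u₂ + v₂) / (v₂ + w₁)} : IntermediateField k K) x)
    (h12 : IsAlgebraic (IntermediateField.adjoin k
      {(u₁ + v₁) / (v₁ + w₂), (u₂ + v₁) / (v₁ + w₂)} : IntermediateField k K) x)
    (h22 : IsAlgebraic (IntermediateField.adjoin k
      {(u₁ + v₂) / (v₂ + w₂), (u₂ + v₂) / (v₂ + w₂)} : IntermediateField k K) x) :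
    IsAlgebraic k x := by
  have hvw : v₁ + w₁ ≠ 0 := hind.add_ne_zero (i := 2) (j := 4) (by decide)
  have hu : u₁ - u₂ ≠ 0 := sub_ne_zero.2 fun h ↦
    absurd (hind.injective (a₁ := 0) (a₂ := 1) h) (by decide)
  set s := (u₁ + v₁) / (v₁ + w₁) with hs
  set t := (u₂ + v₁) / (v₁ + w₁) with ht
  have hst : s - t ≠ 0 := by
    rw [hs, ht, ← sub_div, add_sub_add_right_eq_sub]
    exact div_ne_zero hu hvw
  have hvw_eq : v₁ + w₁ = (u₁ - u₂) / (s - t) := by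
    rw [eq_div_iff hst, hs, ht]
    field_simp
    ring
  have hv_eq : v₁ = s * (v₁ + w₁) - u₁ := by
    rw [hs]
    field_simp
    ring
  let I : Set K := {s, t}
  let J : Set K := {u₁, u₂, v₂, w₂}
  have hgen : Set.range ![u₁, u₂, v₁, v₂, w₁, w₂] ⊆ IntermediateField.adjoin k (I ∪ J) := by
    have hmem : I ∪ J ⊆ IntermediateField.adjoin k (I ∪ J) :=
      IntermediateField.subset_adjoin k _
    have hsm := hmem (show s ∈ I ∪ J by simp [I])
    have htm := hmem (show t ∈ I ∪ J by simp [I])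
    have hu₁ := hmem (show u₁ ∈ I ∪ J by simp [J])
    have hu₂ := hmem (show u₂ ∈ I ∪ J by simp [J])
    have hv₂ := hmem (show v₂ ∈ I ∪ J by simp [J])
    have hw₂ := hmem (show w₂ ∈ I ∪ J by simp [J])
    have hvwm : v₁ + w₁ ∈ IntermediateField.adjoin k (I ∪ J) :=
      hvw_eq ▸ div_mem (sub_mem hu₁ hu₂) (sub_mem hsm htm)
    have hv₁ : v₁ ∈ IntermediateField.adjoin k (I ∪ J) :=
      hv_eq ▸ sub_mem (mul_mem hsm hvwm) hu₁
    have hw₁ : w₁ ∈ IntermediateField.adjoin k (I ∪ J) :=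
      add_sub_cancel_left v₁ w₁ ▸ sub_mem hvwm hv₁
    rintro _ ⟨i, rfl⟩
    fin_cases i <;> assumption
  have hcard : (Set.range ![u₁, u₂, v₁, v₂, w₁, w₂]).encard = 6 := by
    rw [← Set.image_univ, hind.injective.encard_image]
    simp
  have hinsert (a : K) {r : Set K} {n : ℕ∞} (hr : r.encard ≤ n) : (insert a r).encard ≤ n + 1 :=
    (Set.encard_insert_le r a).trans (by gcongr)
  have hI : I.encard ≤ 1 + 1 := hinsert _ (Set.encard_singleton t).le
  have hJ : J.encard ≤ 1 + 1 + 1 + 1 :=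
    hinsert _ (hinsert _ (hinsert _ (Set.encard_singleton w₂).le))
  have hinter := (AlgebraicIndependent.matroid_indep_iff.2 hind.to_subtype_range).closure_inter_closure_eq_loops
    (Set.finite_range _) (Set.subset_univ I) (Set.subset_univ J)
    (fun y hy ↦ mem_matroid_closure_iff.2 (isAlgebraic_algebraMap
      (⟨y, hgen hy⟩ : IntermediateField.adjoin k (I ∪ J))))
    (hcard ▸ (add_le_add hI hJ).trans (by norm_num))
  have hxJ : x ∈ (AlgebraicIndependent.matroid k K).closure J := by
    have hle : IntermediateField.adjoin k {(u₁ + v₂) / (v₂ + w₂), (u₂ + v₂) / (v₂ + w₂)} ≤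
        IntermediateField.adjoin k J := by
      have hmem : J ⊆ IntermediateField.adjoin k J := IntermediateField.subset_adjoin k J
      have hv₂ := hmem (show v₂ ∈ J by simp [J])
      have hvw₂ := add_mem hv₂ (hmem (show w₂ ∈ J by simp [J]))
      rw [IntermediateField.adjoin_le_iff, Set.pair_subset_iff]
      exact ⟨div_mem (add_mem (hmem (by simp [J])) hv₂) hvw₂,
        div_mem (add_mem (hmem (by simp [J])) hv₂) hvw₂⟩
    let := (IntermediateField.inclusion hle).toRingHom.toAlgebra
    have : IsScalarTower (IntermediateField.adjoin k
      {(u₁ + v₂) / (v₂ + w₂), (u₂ + v₂) / (v₂ + w₂)} : IntermediateField k K)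
      (IntermediateField.adjoin k J) K := .of_algebraMap_eq fun _ ↦ rfl
    exact mem_matroid_closure_iff.2 (h22.tower_top _)
  have hx : x ∈ (AlgebraicIndependent.matroid k K).closure ∅ :=
    hinter ▸ ⟨mem_matroid_closure_iff.2 h11, hxJ⟩
  rw [mem_matroid_closure_iff, IntermediateField.isAlgebraic_adjoin_iff, Algebra.adjoin_empty] at hx
  exact Subalgebra.isAlgebraic_of_isAlgebraic_bot hx
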